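/- Fix an integer k ≥ 1 and real numbers a, b. Define λ₁^{(k)}(a,b) as the infimum, over all smooth Γ_k-invariant φ : ℝ³ → ℂ not identically zero (Γ_k-invariance meaning φ(x+k,y,z) = φ(x,y+1,z+x) = φ(x,y,z+1) = φ(x,y,z)), of the Rayleigh quotient (∫_F (|Xφ + i a φ|² + |Yφ + i b φ|²)) / (∫_F |φ|²), where F = (0,k)×(0,1)×(0,1) carries Lebesgue measure, X φ = ∂_x φ + y ∂_z φ and Y φ = ∂_y φ. Then λ₁^{(k)}(a,b) = min{ dist(a, (2π/k)ℤ)² + dist(b, 2πℤ)², 2π }, and this infimum is attained by some smooth Γ_k-invariant φ. -/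

import Mathlib

open MeasureTheory

/-- The horizontal vector field `X = ∂_x + y ∂_z` on the Heisenberg group `ℝ³`,
applied to a function `φ : ℝ³ → ℂ`. -/
noncomputable def heisX (φ : ℝ × ℝ × ℝ → ℂ) (p : ℝ × ℝ × ℝ) : ℂ :=
  fderiv ℝ φ p (1, 0, 0) + p.2.1 • fderiv ℝ φ p (0, 0, 1)

/-- The horizontal vector field `Y = ∂_y` on the Heisenberg group `ℝ³`,
applied to a function `φ : ℝ³ → ℂ`. -/
noncomputable def heisY (φ : ℝ × ℝ × ℝ → ℂ) (p : ℝ × ℝ × ℝ) : ℂ :=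
  fderiv ℝ φ p (0, 1, 0)

/-- `dist (t, cℤ) = inf_{n ∈ ℤ} |t - c n|`. -/
noncomputable def distZ (t c : ℝ) : ℝ := ⨅ n : ℤ, |t - c * n|

/-- The fundamental domain `F = (0,k) × (0,1) × (0,1)` of `Γ_k \ ℍ¹`. -/
def heisF (k : ℕ) : Set (ℝ × ℝ × ℝ) :=
  Set.Ioo (0 : ℝ) (k : ℝ) ×ˢ (Set.Ioo (0 : ℝ) 1 ×ˢ Set.Ioo (0 : ℝ) 1)

/-- The set of Rayleigh quotients of the magnetic horizontal Laplacian on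
`Γ_k \ ℍ¹` with magnetic potential `a dx + b dy`, over smooth `Γ_k`-invariant
test functions `φ` not identically zero. -/
def heisRayleighSet (k : ℕ) (a b : ℝ) : Set ℝ :=
  {r : ℝ | ∃ φ : ℝ × ℝ × ℝ → ℂ, ContDiff ℝ (⊤ : ℕ∞) φ ∧
    (∀ x y z : ℝ, φ (x + k, y, z) = φ (x, y, z) ∧
      φ (x, y + 1, z + x) = φ (x, y, z) ∧ φ (x, y, z + 1) = φ (x, y, z)) ∧
    (∃ p, φ p ≠ 0) ∧
    r = (∫ p in heisF k,
          (‖heisX φ p + Complex.I * (a : ℂ) * φ p‖ ^ 2 +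
            ‖heisY φ p + Complex.I * (b : ℂ) * φ p‖ ^ 2)) /
        (∫ p in heisF k, ‖φ p‖ ^ 2)}

/-- Term-by-term integration of a pointwise convergent series of continuous nonnegative functions
with continuous sum. -/
lemma hasSum_intervalIntegral_of_continuous_nonneg {ι : Type*} [Countable ι] {F : ι → ℝ → ℝ}
    {f : ℝ → ℝ} (a b : ℝ) (hF : ∀ n, Continuous (F n)) (hF0 : ∀ n t, 0 ≤ F n t)
    (hf : Continuous f) (h : ∀ t, HasSum (fun n => F n t) (f t)) :
    HasSum (fun n => ∫ t in a..b, F n t) (∫ t in a..b, f t) := by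
  refine intervalIntegral.hasSum_integral_of_dominated_convergence F
    (fun n => (hF n).aestronglyMeasurable) (fun n => ?_) ?_ ?_ ?_
  · exact Filter.Eventually.of_forall fun t _ => by rw [Real.norm_of_nonneg (hF0 n t)]
  · exact Filter.Eventually.of_forall fun t _ => (h t).summable
  · simp_rw [fun t => (h t).tsum_eq]
    exact hf.intervalIntegrable _ _
  · exact Filter.Eventually.of_forall fun t _ => h t

/-- Differentiation under the integral sign for a jointly continuous derivative. -/
lemma hasDerivAt_intervalIntegral_of_continuous {F F' : ℝ → ℝ → ℂ} (a b : ℝ)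
    (hF : Continuous (Function.uncurry F)) (hF' : Continuous (Function.uncurry F'))
    (h : ∀ x t, HasDerivAt (fun x => F x t) (F' x t) x) (x : ℝ) :
    HasDerivAt (fun x => ∫ t in a..b, F x t) (∫ t in a..b, F' x t) x := by
  obtain ⟨C, hC⟩ := ((isCompact_closedBall x 1).prod
    (isCompact_uIcc (a := a) (b := b))).exists_bound_of_continuousOn hF'.continuousOn
  refine (intervalIntegral.hasDerivAt_integral_of_dominated_loc_of_deriv_le (bound := fun _ => C)
    (Metric.closedBall_mem_nhds x one_pos) ?_ ?_ ?_ ?_ ?_ ?_).2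
  · exact Filter.Eventually.of_forall fun y =>
      (hF.comp (Continuous.prodMk_right y)).aestronglyMeasurable
  · exact (hF.comp (Continuous.prodMk_right x)).intervalIntegrable _ _
  · exact (hF'.comp (Continuous.prodMk_right x)).aestronglyMeasurable
  · exact Filter.Eventually.of_forall fun t ht y hy =>
      hC (y, t) ⟨hy, Set.uIoc_subset_uIcc ht⟩
  · exact intervalIntegrable_const
  · exact Filter.Eventually.of_forall fun t _ y _ => h y t

/-- Parseval's identity for a continuous function on `[0, L]`. -/
lemma hasSum_norm_sq_integral_exp {L : ℝ} (hL : 0 < L) {u : ℝ → ℂ} (hu : Continuous u) :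
    HasSum (fun n : ℤ =>
        ‖∫ t in (0 : ℝ)..L, Complex.exp (-(2 * Real.pi * Complex.I * n / L * t)) * u t‖ ^ 2)
      (L * ∫ t in (0 : ℝ)..L, ‖u t‖ ^ 2) := by
  have hmem : MemLp u 2 (volume.restrict (Set.Ioc 0 L)) := by
    obtain ⟨C, hC⟩ := (isCompact_Icc (a := 0) (b := L)).exists_bound_of_continuousOn
      hu.continuousOn
    exact MemLp.of_bound hu.aestronglyMeasurable C <|
      (ae_restrict_mem measurableSet_Ioc).mono fun t ht => hC t (Set.Ioc_subset_Icc_self ht)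
  have h := (hasSum_sq_fourierCoeffOn hL hmem).mul_left (L ^ 2)
  have hsum : L ^ 2 * (L - 0)⁻¹ • ∫ t in (0 : ℝ)..L, ‖u t‖ ^ 2 =
      L * ∫ t in (0 : ℝ)..L, ‖u t‖ ^ 2 := by
    simp only [sub_zero, smul_eq_mul]
    field_simp
  rw [hsum] at h
  refine h.congr_fun fun n => ?_
  rw [fourierCoeffOn_eq_integral]
  simp only [sub_zero, fourier_coe_apply, norm_smul, smul_eq_mul, mul_pow]
  rw [Real.norm_of_nonneg (by positivity), ← mul_assoc, ← mul_pow, mul_one_div_cancel hL.ne',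
    one_pow, one_mul]
  congr 3
  ext t
  congr 2
  push_cast
  ring

lemma distZ_nonneg (t c : ℝ) : 0 ≤ distZ t c := Real.iInf_nonneg fun _ => abs_nonneg _

lemma distZ_le (t c : ℝ) (n : ℤ) : distZ t c ≤ |t - c * n| :=
  ciInf_le ⟨0, by rintro _ ⟨n, rfl⟩; exact abs_nonneg _⟩ n

lemma exists_distZ_eq (t : ℝ) {c : ℝ} (hc : 0 < c) : ∃ n : ℤ, distZ t c = |t - c * n| := by
  refine ⟨round (t / c), le_antisymm (distZ_le _ _ _) (le_ciInf fun n => ?_)⟩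
  have key : ∀ m : ℤ, |t - c * m| = c * |t / c - m| := fun m => by
    rw [← abs_of_pos hc, ← abs_mul, abs_of_pos hc, mul_sub, mul_div_cancel₀ _ hc.ne']
  rw [key, key]
  exact mul_le_mul_of_nonneg_left (round_le _ _) hc.le

/-- The magnetic Wirtinger inequality on a circle of length `L`. -/
lemma distZ_sq_mul_integral_le {L : ℝ} (hL : 0 < L) (a : ℝ) {u u' : ℝ → ℂ} (hu' : Continuous u')
    (h : ∀ t, HasDerivAt u (u' t) t) (hper : u L = u 0) :
    distZ a (2 * Real.pi / L) ^ 2 * ∫ t in (0 : ℝ)..L, ‖u t‖ ^ 2 ≤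
      ∫ t in (0 : ℝ)..L, ‖u' t + Complex.I * a * u t‖ ^ 2 := by
  have hu : Continuous u := continuous_iff_continuousAt.2 fun t => (h t).continuousAt
  have h1 := (hasSum_norm_sq_integral_exp hL hu).mul_left (distZ a (2 * Real.pi / L) ^ 2)
  have h2 := hasSum_norm_sq_integral_exp hL (u := fun t => u' t + Complex.I * a * u t)
    (by fun_prop)
  have h3 := hasSum_le (fun n => ?_) h1 h2
  · rw [mul_left_comm] at h3
    exact le_of_mul_le_mul_left h3 hL
  · set e : ℝ → ℂ := fun t => Complex.exp (-(2 * Real.pi * Complex.I * n / L * t)) with he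
    have hec : Continuous e := by fun_prop
    have hed : ∀ t, HasDerivAt e (-(2 * Real.pi * Complex.I * n / L) * e t) t := fun t => by
      have h0 := ((Complex.ofRealCLM.hasDerivAt (x := t)).const_mul
        (2 * Real.pi * Complex.I * n / L)).neg.cexp
      refine h0.congr_deriv ?_
      simp [he, mul_comm]
    have heL : e L = 1 := by
      have hLC : (L : ℂ) ≠ 0 := by exact_mod_cast hL.ne'
      simp only [he]
      rw [div_mul_cancel₀ _ hLC, Complex.exp_eq_one_iff]
      exact ⟨-n, by push_cast; ring⟩
    have he0 : e 0 = 1 := by simp [he]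
    have hibp : ∫ t in (0 : ℝ)..L, (-(2 * Real.pi * Complex.I * n / L) * e t * u t + e t * u' t)
        = 0 := by
      rw [intervalIntegral.integral_eq_sub_of_hasDerivAt (fun t _ => (hed t).mul (h t))
        ((by fun_prop : Continuous _).intervalIntegrable _ _)]
      simp [heL, he0, hper]
    have hval : ∫ t in (0 : ℝ)..L, e t * (u' t + Complex.I * a * u t) =
        Complex.I * ((a - 2 * Real.pi / L * (-n : ℤ) : ℝ) : ℂ) * ∫ t in (0 : ℝ)..L, e t * u t := by
      rw [← intervalIntegral.integral_const_mul, ← sub_eq_zero,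
        ← intervalIntegral.integral_sub ((by fun_prop : Continuous _).intervalIntegrable _ _)
        ((by fun_prop : Continuous _).intervalIntegrable _ _), ← hibp]
      congr 1
      ext t
      push_cast
      ring
    rw [hval, norm_mul, norm_mul, Complex.norm_I, one_mul, mul_pow, Complex.norm_real,
      Real.norm_eq_abs]
    gcongr
    · exact distZ_nonneg _ _
    · exact distZ_le _ _ _

/-- The integral of the imaginary part of a derivative vanishes when the primitive agrees at the end
points. -/
lemma integral_im_deriv_eq_zero {W W' : ℝ → ℂ} {L : ℝ} (h : ∀ t, HasDerivAt W (W' t) t)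
    (hc : Continuous W') (hW : W L = W 0) : ∫ t in (0 : ℝ)..L, (W' t).im = 0 := by
  have hd : ∀ t, HasDerivAt (fun t => (W t).im) (W' t).im t := fun t =>
    (Complex.imCLM.hasFDerivAt.comp_hasDerivAt t (h t))
  rw [intervalIntegral.integral_eq_sub_of_hasDerivAt (fun t _ => hd t)
    ((Complex.continuous_im.comp hc).intervalIntegrable _ _), hW, sub_self]

lemma continuous_intervalIntegral_snd {E : Type*} [NormedAddCommGroup E] [NormedSpace ℝ E]
    {g : ℝ × ℝ → E} (hg : Continuous g) (a b : ℝ) : Continuous fun x => ∫ y in a..b, g (x, y) :=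
  intervalIntegral.continuous_parametric_intervalIntegral_of_continuous'
    (f := fun x y => g (x, y)) hg a b

lemma intervalIntegral_swap_of_continuous {g : ℝ × ℝ → ℝ} (hg : Continuous g) (a b c d : ℝ) :
    ∫ x in a..b, ∫ y in c..d, g (x, y) = ∫ y in c..d, ∫ x in a..b, g (x, y) :=
  intervalIntegral_intervalIntegral_swap (F := fun x y => g (x, y))
    ((hg.continuousOn.integrableOn_compact (isCompact_uIcc.prod isCompact_uIcc)).mono_set
      (Set.prod_mono Set.uIoc_subset_uIcc Set.uIoc_subset_uIcc))

/-- The Weitzenböck-type identity for the magnetic gradient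
`(∂_x + 2πi m y + i a, ∂_y + i b)` acting on functions `f` that are `L`-periodic in `x` and
quasi-periodic in `y`. -/
lemma integral_norm_sq_creation {L a b s : ℝ} {m : ℤ} (hs : s ^ 2 = 1) {f fx fy fxy : ℝ × ℝ → ℂ}
    (hf : Continuous f) (hfx : Continuous fx) (hfy : Continuous fy) (hfxy : Continuous fxy)
    (dx : ∀ x y, HasDerivAt (fun x => f (x, y)) (fx (x, y)) x)
    (dy : ∀ x y, HasDerivAt (fun y => f (x, y)) (fy (x, y)) y)
    (dyx : ∀ x y, HasDerivAt (fun x => fy (x, y)) (fxy (x, y)) x)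
    (dxy : ∀ x y, HasDerivAt (fun y => fx (x, y)) (fxy (x, y)) y)
    (hperx : ∀ x y, f (x + L, y) = f (x, y))
    (hpery : ∀ x y, f (x, y + 1) = Complex.exp (-(2 * Real.pi * Complex.I * m * x)) * f (x, y)) :
    ∫ x in (0 : ℝ)..L, ∫ y in (0 : ℝ)..1,
        ‖(fx (x, y) + y * (2 * Real.pi * Complex.I * m * f (x, y)) + Complex.I * a * f (x, y)) +
          s * Complex.I * (fy (x, y) + Complex.I * b * f (x, y))‖ ^ 2 =
      (∫ x in (0 : ℝ)..L, ∫ y in (0 : ℝ)..1,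
        (‖fx (x, y) + y * (2 * Real.pi * Complex.I * m * f (x, y)) + Complex.I * a * f (x, y)‖ ^ 2 +
          ‖fy (x, y) + Complex.I * b * f (x, y)‖ ^ 2)) -
        2 * Real.pi * s * m * ∫ x in (0 : ℝ)..L, ∫ y in (0 : ℝ)..1, ‖f (x, y)‖ ^ 2 := by
  set p : ℝ × ℝ → ℂ := fun v =>
    fx v + v.2 * (2 * Real.pi * Complex.I * m * f v) + Complex.I * a * f v with hp
  set q : ℝ × ℝ → ℂ := fun v => fy v + Complex.I * b * f v with hq
  set D₁ : ℝ × ℝ → ℂ := fun v =>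
    fx v * star (q v) + f v * star (fxy v + Complex.I * b * fx v) with hD₁
  set D₂ : ℝ × ℝ → ℂ := fun v =>
    fy v * star (p v) + f v * star (fxy v + (2 * Real.pi * Complex.I * m * f v +
      v.2 * (2 * Real.pi * Complex.I * m * fy v)) + Complex.I * a * fy v) with hD₂
  have hpc : Continuous p := by fun_prop
  have hqc : Continuous q := by fun_prop
  have hD₁c : Continuous D₁ := by fun_prop
  have hD₂c : Continuous D₂ := by fun_prop
  have hfyx : ∀ x y, fy (x + L, y) = fy (x, y) := fun x y =>
    (dy (x + L) y).unique (by simpa only [hperx] using dy x y)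
  have hfxy1 : ∀ x y, fx (x, y + 1) = Complex.exp (-(2 * Real.pi * Complex.I * m * x)) *
      (fx (x, y) - 2 * Real.pi * Complex.I * m * f (x, y)) := fun x y => by
    refine (dx x (y + 1)).unique ?_
    simp only [hpery]
    have h0 := (((Complex.ofRealCLM.hasDerivAt (x := x)).const_mul
      (2 * Real.pi * Complex.I * m)).neg.cexp).mul (dx x y)
    refine h0.congr_deriv ?_
    simp
    ring
  have hexp : ∀ x : ℝ, Complex.exp (-(2 * Real.pi * Complex.I * m * x)) *
      star (Complex.exp (-(2 * Real.pi * Complex.I * m * x))) = 1 := fun x => by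
    rw [Complex.star_def, Complex.mul_conj, Complex.normSq_eq_norm_sq, Complex.norm_exp]
    simp
  have I₁ : ∫ x in (0 : ℝ)..L, ∫ y in (0 : ℝ)..1, (D₁ (x, y)).im = 0 := by
    rw [intervalIntegral_swap_of_continuous (g := fun v => (D₁ v).im) (by fun_prop)]
    refine intervalIntegral.integral_zero_ae (Filter.Eventually.of_forall fun y _ => ?_)
    refine integral_im_deriv_eq_zero (W := fun x => f (x, y) * star (q (x, y)))
      (W' := fun x => D₁ (x, y)) (fun x => ?_) (by fun_prop) ?_
    · exact (dx x y).mul (((dyx x y).add ((dx x y).const_mul _)).star)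
    · have h1 := hperx 0 y
      have h2 := hfyx 0 y
      rw [zero_add] at h1 h2
      simp only [hq, h1, h2]
  have I₂ : ∫ x in (0 : ℝ)..L, ∫ y in (0 : ℝ)..1, (D₂ (x, y)).im = 0 := by
    refine intervalIntegral.integral_zero_ae (Filter.Eventually.of_forall fun x _ => ?_)
    refine integral_im_deriv_eq_zero (W := fun y => f (x, y) * star (p (x, y)))
      (W' := fun y => D₂ (x, y)) (fun y => ?_) (by fun_prop) ?_
    · have h0 := (dy x y).mul (((dxy x y).add ((Complex.ofRealCLM.hasDerivAt (x := y)).mul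
        ((dy x y).const_mul (2 * Real.pi * Complex.I * m)))).add
          ((dy x y).const_mul (Complex.I * a))).star
      refine h0.congr_deriv ?_
      simp [hD₂, hp]
    · have h1 := hpery x 0
      have h2 := hfxy1 x 0
      rw [zero_add] at h1 h2
      have h3 : p (x, 1) = Complex.exp (-(2 * Real.pi * Complex.I * m * x)) * p (x, 0) := by
        simp only [hp, h1, h2]
        push_cast
        ring
      rw [h1, h3, star_mul']
      linear_combination (f (x, 0) * star (p (x, 0))) * hexp x
  have hpt : ∀ v, ‖p v + s * Complex.I * q v‖ ^ 2 = (‖p v‖ ^ 2 + ‖q v‖ ^ 2) -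
      2 * Real.pi * s * m * ‖f v‖ ^ 2 + s * ((D₁ v).im - (D₂ v).im) := fun v => by
    simp only [Complex.sq_norm, Complex.normSq_apply, hD₁, hD₂, hp, hq]
    simp
    linear_combination (((fy v).re - b * (f v).im) ^ 2 + ((fy v).im + b * (f v).re) ^ 2) * hs
  have hgi : ∀ g : ℝ × ℝ → ℝ, Continuous g → ∀ x,
      IntervalIntegrable (fun y => g (x, y)) volume 0 1 :=
    fun g hg x => (by fun_prop : Continuous fun y => g (x, y)).intervalIntegrable _ _
  have hgi' : ∀ g : ℝ × ℝ → ℝ, Continuous g →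
      IntervalIntegrable (fun x => ∫ y in (0 : ℝ)..1, g (x, y)) volume 0 L :=
    fun g hg => (continuous_intervalIntegral_snd hg 0 1).intervalIntegrable _ _
  have c₁ : Continuous fun v => ‖p v‖ ^ 2 + ‖q v‖ ^ 2 := by fun_prop
  have c₂ : Continuous fun v => 2 * Real.pi * s * m * ‖f v‖ ^ 2 := by fun_prop
  have c₃ : Continuous fun v => s * ((D₁ v).im - (D₂ v).im) := by fun_prop
  have hsum : ∀ x, ∫ y in (0 : ℝ)..1, ‖p (x, y) + s * Complex.I * q (x, y)‖ ^ 2 =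
      (∫ y in (0 : ℝ)..1, (‖p (x, y)‖ ^ 2 + ‖q (x, y)‖ ^ 2)) -
      2 * Real.pi * s * m * (∫ y in (0 : ℝ)..1, ‖f (x, y)‖ ^ 2) +
      s * ((∫ y in (0 : ℝ)..1, (D₁ (x, y)).im) - ∫ y in (0 : ℝ)..1, (D₂ (x, y)).im) := fun x => by
    simp only [hpt]
    rw [intervalIntegral.integral_add ((hgi _ c₁ x).sub (hgi _ c₂ x)) (hgi _ c₃ x),
      intervalIntegral.integral_sub (hgi _ c₁ x) (hgi _ c₂ x),
      intervalIntegral.integral_const_mul, intervalIntegral.integral_const_mul,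
      intervalIntegral.integral_sub (hgi (fun v => (D₁ v).im) (by fun_prop) x)
        (hgi (fun v => (D₂ v).im) (by fun_prop) x)]
  have e₁ := hgi' _ c₁
  have e₂ := (hgi' (fun v => ‖f v‖ ^ 2) (by fun_prop)).const_mul (2 * Real.pi * s * m)
  have e₃ := hgi' (fun v => (D₁ v).im) (by fun_prop)
  have e₄ := hgi' (fun v => (D₂ v).im) (by fun_prop)
  calc _ = ∫ x in (0 : ℝ)..L, ∫ y in (0 : ℝ)..1, ‖p (x, y) + s * Complex.I * q (x, y)‖ ^ 2 := rfl
    _ = _ := by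
      simp only [hsum]
      rw [intervalIntegral.integral_add (e₁.sub e₂) ((e₃.sub e₄).const_mul s),
        intervalIntegral.integral_sub e₁ e₂, intervalIntegral.integral_const_mul,
        intervalIntegral.integral_const_mul, intervalIntegral.integral_sub e₃ e₄, I₁, I₂]
      simp [hp, hq]

/-- The lower bound on a single Fourier mode in the central direction. -/
lemma min_mul_integral_norm_sq_le {L a b : ℝ} (hL : 0 < L) {m : ℤ} {f fx fy fxy : ℝ × ℝ → ℂ}
    (hf : Continuous f) (hfx : Continuous fx) (hfy : Continuous fy) (hfxy : Continuous fxy)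
    (dx : ∀ x y, HasDerivAt (fun x => f (x, y)) (fx (x, y)) x)
    (dy : ∀ x y, HasDerivAt (fun y => f (x, y)) (fy (x, y)) y)
    (dyx : ∀ x y, HasDerivAt (fun x => fy (x, y)) (fxy (x, y)) x)
    (dxy : ∀ x y, HasDerivAt (fun y => fx (x, y)) (fxy (x, y)) y)
    (hperx : ∀ x y, f (x + L, y) = f (x, y))
    (hpery : ∀ x y, f (x, y + 1) = Complex.exp (-(2 * Real.pi * Complex.I * m * x)) * f (x, y)) :
    min (distZ a (2 * Real.pi / L) ^ 2 + distZ b (2 * Real.pi) ^ 2) (2 * Real.pi) *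
        ∫ x in (0 : ℝ)..L, ∫ y in (0 : ℝ)..1, ‖f (x, y)‖ ^ 2 ≤
      ∫ x in (0 : ℝ)..L, ∫ y in (0 : ℝ)..1,
        (‖fx (x, y) + y * (2 * Real.pi * Complex.I * m * f (x, y)) + Complex.I * a * f (x, y)‖ ^ 2 +
          ‖fy (x, y) + Complex.I * b * f (x, y)‖ ^ 2) := by
  have hN : 0 ≤ ∫ x in (0 : ℝ)..L, ∫ y in (0 : ℝ)..1, ‖f (x, y)‖ ^ 2 :=
    intervalIntegral.integral_nonneg hL.le fun x _ =>
      intervalIntegral.integral_nonneg zero_le_one fun y _ => by positivity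
  rcases eq_or_ne m 0 with rfl | hm
  · refine (mul_le_mul_of_nonneg_right (min_le_left _ _) hN).trans ?_
    simp only [Int.cast_zero, mul_zero, zero_mul, add_zero, neg_zero, Complex.exp_zero,
      one_mul] at hpery ⊢
    have cx : Continuous fun v => ‖fx v + Complex.I * a * f v‖ ^ 2 := by fun_prop
    have cy : Continuous fun v => ‖fy v + Complex.I * b * f v‖ ^ 2 := by fun_prop
    have cf : Continuous fun v => ‖f v‖ ^ 2 := by fun_prop
    have hx : distZ a (2 * Real.pi / L) ^ 2 *
        ∫ x in (0 : ℝ)..L, ∫ y in (0 : ℝ)..1, ‖f (x, y)‖ ^ 2 ≤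
        ∫ x in (0 : ℝ)..L, ∫ y in (0 : ℝ)..1, ‖fx (x, y) + Complex.I * a * f (x, y)‖ ^ 2 := by
      rw [intervalIntegral_swap_of_continuous cx, intervalIntegral_swap_of_continuous cf,
        ← intervalIntegral.integral_const_mul]
      refine intervalIntegral.integral_mono_on zero_le_one
        (Continuous.intervalIntegrable ?_ _ _) (Continuous.intervalIntegrable ?_ _ _)
        fun y _ => distZ_sq_mul_integral_le hL a (by fun_prop) (fun x => dx x y)
          (by simpa using hperx 0 y)
      · exact (continuous_intervalIntegral_snd (cf.comp continuous_swap) 0 L).const_mul _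
      · exact continuous_intervalIntegral_snd (cx.comp continuous_swap) 0 L
    have hy : distZ b (2 * Real.pi) ^ 2 *
        ∫ x in (0 : ℝ)..L, ∫ y in (0 : ℝ)..1, ‖f (x, y)‖ ^ 2 ≤
        ∫ x in (0 : ℝ)..L, ∫ y in (0 : ℝ)..1, ‖fy (x, y) + Complex.I * b * f (x, y)‖ ^ 2 := by
      rw [← intervalIntegral.integral_const_mul]
      refine intervalIntegral.integral_mono_on hL.le
        (Continuous.intervalIntegrable ?_ _ _) (Continuous.intervalIntegrable ?_ _ _)
        fun x _ => by
          simpa using distZ_sq_mul_integral_le one_pos b (u := fun y => f (x, y))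
            (u' := fun y => fy (x, y)) (by fun_prop) (fun y => dy x y) (by simpa using hpery x 0)
      · exact (continuous_intervalIntegral_snd cf 0 1).const_mul _
      · exact continuous_intervalIntegral_snd cy 0 1
    rw [add_mul]
    refine (add_le_add hx hy).trans_eq ?_
    rw [← intervalIntegral.integral_add
      ((continuous_intervalIntegral_snd cx 0 1).intervalIntegrable _ _)
      ((continuous_intervalIntegral_snd cy 0 1).intervalIntegrable _ _)]
    congr 1
    ext x
    rw [← intervalIntegral.integral_add
      ((by fun_prop : Continuous _).intervalIntegrable _ _)
      ((by fun_prop : Continuous _).intervalIntegrable _ _)]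
  · refine (mul_le_mul_of_nonneg_right (min_le_right _ _) hN).trans ?_
    obtain ⟨s, hs, hsm⟩ : ∃ s : ℝ, s ^ 2 = 1 ∧ 1 ≤ s * m := by
      rcases lt_or_gt_of_ne hm with h | h
      · refine ⟨-1, by norm_num, ?_⟩
        have : (m : ℝ) ≤ -1 := by exact_mod_cast (by lia : m ≤ -1)
        linarith
      · refine ⟨1, by norm_num, ?_⟩
        have : (1 : ℝ) ≤ m := by exact_mod_cast (by lia : 1 ≤ m)
        linarith
    have key := integral_norm_sq_creation (a := a) (b := b) hs hf hfx hfy hfxy dx dy dyx dxy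
      hperx hpery
    have : 2 * Real.pi * (∫ x in (0 : ℝ)..L, ∫ y in (0 : ℝ)..1, ‖f (x, y)‖ ^ 2) ≤
        2 * Real.pi * s * m * ∫ x in (0 : ℝ)..L, ∫ y in (0 : ℝ)..1, ‖f (x, y)‖ ^ 2 := by
      refine mul_le_mul_of_nonneg_right ?_ hN
      nlinarith [Real.pi_pos]
    rw [eq_comm, sub_eq_iff_eq_add] at key
    rw [key]
    exact this.trans (le_add_of_nonneg_left (intervalIntegral.integral_nonneg hL.le fun x _ =>
      intervalIntegral.integral_nonneg zero_le_one fun y _ => by positivity))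

/-- The Fourier coefficients of a function on `ℝ³` in the central variable. -/
noncomputable def zCoeff (m : ℤ) (g : ℝ × ℝ × ℝ → ℂ) (v : ℝ × ℝ) : ℂ :=
  ∫ z in (0 : ℝ)..1, Complex.exp (-(2 * Real.pi * Complex.I * m * z)) * g (v.1, v.2, z)

lemma continuous_zCoeff (m : ℤ) {g : ℝ × ℝ × ℝ → ℂ} (hg : Continuous g) :
    Continuous (zCoeff m g) :=
  intervalIntegral.continuous_parametric_intervalIntegral_of_continuous'
    (f := fun (v : ℝ × ℝ) (z : ℝ) =>
      Complex.exp (-(2 * Real.pi * Complex.I * m * z)) * g (v.1, v.2, z))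
    (by unfold Function.uncurry; fun_prop) 0 1

lemma zCoeff_add (m : ℤ) {g h : ℝ × ℝ × ℝ → ℂ} (hg : Continuous g) (hh : Continuous h)
    (v : ℝ × ℝ) : zCoeff m (fun p => g p + h p) v = zCoeff m g v + zCoeff m h v := by
  simp only [zCoeff, mul_add]
  exact intervalIntegral.integral_add ((by fun_prop : Continuous _).intervalIntegrable _ _)
    ((by fun_prop : Continuous _).intervalIntegrable _ _)

lemma zCoeff_const_mul (m : ℤ) (g : ℝ × ℝ × ℝ → ℂ) (c : ℂ) (v : ℝ × ℝ) :
    zCoeff m (fun p => c * g p) v = c * zCoeff m g v := by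
  simp only [zCoeff, mul_left_comm _ c]
  exact intervalIntegral.integral_const_mul _ _

lemma zCoeff_snd_smul (m : ℤ) (g : ℝ × ℝ × ℝ → ℂ) (v : ℝ × ℝ) :
    zCoeff m (fun p => p.2.1 • g p) v = v.2 * zCoeff m g v := by
  simp only [zCoeff, Complex.real_smul, mul_left_comm _ (v.2 : ℂ)]
  exact intervalIntegral.integral_const_mul _ _

/-- Parseval's identity in the central variable, integrated over the horizontal variables. -/
lemma hasSum_integral_norm_sq_zCoeff {g : ℝ × ℝ × ℝ → ℂ} (hg : Continuous g) (L : ℝ) :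
    HasSum (fun m : ℤ => ∫ x in (0 : ℝ)..L, ∫ y in (0 : ℝ)..1, ‖zCoeff m g (x, y)‖ ^ 2)
      (∫ x in (0 : ℝ)..L, ∫ y in (0 : ℝ)..1, ∫ z in (0 : ℝ)..1, ‖g (x, y, z)‖ ^ 2) := by
  have hc : ∀ m, Continuous fun v => ‖zCoeff m g v‖ ^ 2 := fun m =>
    (continuous_zCoeff m hg).norm.pow 2
  have hs : Continuous fun v : ℝ × ℝ => ∫ z in (0 : ℝ)..1, ‖g (v.1, v.2, z)‖ ^ 2 :=
    intervalIntegral.continuous_parametric_intervalIntegral_of_continuous'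
      (f := fun (v : ℝ × ℝ) (z : ℝ) => ‖g (v.1, v.2, z)‖ ^ 2)
      (by unfold Function.uncurry; fun_prop) 0 1
  refine hasSum_intervalIntegral_of_continuous_nonneg 0 L
    (fun m => continuous_intervalIntegral_snd (hc m) 0 1)
    (fun m x => intervalIntegral.integral_nonneg zero_le_one fun y _ => by positivity)
    (continuous_intervalIntegral_snd hs 0 1) fun x => ?_
  refine hasSum_intervalIntegral_of_continuous_nonneg 0 1
    (fun m => (hc m).comp (Continuous.prodMk_right x)) (fun m y => by positivity)
    (hs.comp (Continuous.prodMk_right x)) fun y => ?_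
  simpa [zCoeff] using hasSum_norm_sq_integral_exp one_pos (u := fun z => g (x, y, z))
    (by fun_prop)

section Partials

variable {φ : ℝ × ℝ × ℝ → ℂ}

lemma contDiff_fderiv_apply (hφ : ContDiff ℝ (⊤ : ℕ∞) φ) (v : ℝ × ℝ × ℝ) :
    ContDiff ℝ (⊤ : ℕ∞) fun p => fderiv ℝ φ p v :=
  (hφ.fderiv_right (by simp)).clm_apply contDiff_const

lemma fderiv_fderiv_apply_comm (hφ : ContDiff ℝ (⊤ : ℕ∞) φ) (v w p : ℝ × ℝ × ℝ) :
    fderiv ℝ (fun p => fderiv ℝ φ p v) p w = fderiv ℝ (fun p => fderiv ℝ φ p w) p v := by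
  have hd : DifferentiableAt ℝ (fderiv ℝ φ) p :=
    ((hφ.fderiv_right (m := 1) (by norm_cast)).differentiable (by simp)) p
  have hsymm : IsSymmSndFDerivAt ℝ φ p := hφ.contDiffAt.isSymmSndFDerivAt (by
    rw [minSmoothness_of_isRCLikeNormedField]
    exact WithTop.coe_le_coe.2 (le_top : (2 : ℕ∞) ≤ ⊤))
  rw [fderiv_clm_apply hd (by fun_prop), fderiv_clm_apply hd (by fun_prop)]
  simpa using hsymm w v

lemma hasDerivAt_fst (hφ : ContDiff ℝ (⊤ : ℕ∞) φ) (x y z : ℝ) :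
    HasDerivAt (fun x => φ (x, y, z)) (fderiv ℝ φ (x, y, z) (1, 0, 0)) x :=
  ((hφ.differentiable (by simp)) (x, y, z)).hasFDerivAt.comp_hasDerivAt x
    ((hasDerivAt_id x).prodMk ((hasDerivAt_const x y).prodMk (hasDerivAt_const x z)))

lemma hasDerivAt_snd (hφ : ContDiff ℝ (⊤ : ℕ∞) φ) (x y z : ℝ) :
    HasDerivAt (fun y => φ (x, y, z)) (fderiv ℝ φ (x, y, z) (0, 1, 0)) y :=
  ((hφ.differentiable (by simp)) (x, y, z)).hasFDerivAt.comp_hasDerivAt y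
    ((hasDerivAt_const y x).prodMk ((hasDerivAt_id y).prodMk (hasDerivAt_const y z)))

lemma hasDerivAt_trd (hφ : ContDiff ℝ (⊤ : ℕ∞) φ) (x y z : ℝ) :
    HasDerivAt (fun z => φ (x, y, z)) (fderiv ℝ φ (x, y, z) (0, 0, 1)) z :=
  ((hφ.differentiable (by simp)) (x, y, z)).hasFDerivAt.comp_hasDerivAt z
    ((hasDerivAt_const z x).prodMk ((hasDerivAt_const z y).prodMk (hasDerivAt_id z)))

lemma hasDerivAt_zCoeff_fst (hφ : ContDiff ℝ (⊤ : ℕ∞) φ) (m : ℤ) (x y : ℝ) :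
    HasDerivAt (fun x => zCoeff m φ (x, y)) (zCoeff m (fun p => fderiv ℝ φ p (1, 0, 0)) (x, y))
      x := by
  have h1 := hφ.continuous
  have h2 := (contDiff_fderiv_apply hφ (1, 0, 0)).continuous
  exact hasDerivAt_intervalIntegral_of_continuous
    (F := fun x z => Complex.exp (-(2 * Real.pi * Complex.I * m * z)) * φ (x, y, z))
    (F' := fun x z => Complex.exp (-(2 * Real.pi * Complex.I * m * z)) *
      fderiv ℝ φ (x, y, z) (1, 0, 0)) 0 1
    (by unfold Function.uncurry; fun_prop)
    (by
      unfold Function.uncurry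
      exact (by fun_prop : Continuous _).mul
        (h2.comp (by fun_prop : Continuous fun v : ℝ × ℝ => (v.1, y, v.2))))
    (fun x z => (hasDerivAt_fst hφ x y z).const_mul _) x

lemma hasDerivAt_zCoeff_snd (hφ : ContDiff ℝ (⊤ : ℕ∞) φ) (m : ℤ) (x y : ℝ) :
    HasDerivAt (fun y => zCoeff m φ (x, y)) (zCoeff m (fun p => fderiv ℝ φ p (0, 1, 0)) (x, y))
      y := by
  have h1 := hφ.continuous
  have h2 := (contDiff_fderiv_apply hφ (0, 1, 0)).continuous
  exact hasDerivAt_intervalIntegral_of_continuous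
    (F := fun y z => Complex.exp (-(2 * Real.pi * Complex.I * m * z)) * φ (x, y, z))
    (F' := fun y z => Complex.exp (-(2 * Real.pi * Complex.I * m * z)) *
      fderiv ℝ φ (x, y, z) (0, 1, 0)) 0 1
    (by unfold Function.uncurry; fun_prop)
    (by
      unfold Function.uncurry
      exact (by fun_prop : Continuous _).mul
        (h2.comp (by fun_prop : Continuous fun v : ℝ × ℝ => (x, v.1, v.2))))
    (fun y z => (hasDerivAt_snd hφ x y z).const_mul _) y

lemma hasDerivAt_exp_central (m : ℤ) (z : ℝ) :
    HasDerivAt (fun z : ℝ => Complex.exp (-(2 * Real.pi * Complex.I * m * z)))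
      (-(2 * Real.pi * Complex.I * m) * Complex.exp (-(2 * Real.pi * Complex.I * m * z))) z := by
  refine ((Complex.ofRealCLM.hasDerivAt (x := z)).const_mul
    (2 * Real.pi * Complex.I * m)).neg.cexp.congr_deriv ?_
  simp [mul_comm]

lemma exp_central_periodic (m : ℤ) :
    Function.Periodic (fun z : ℝ => Complex.exp (-(2 * Real.pi * Complex.I * m * z))) 1 := by
  intro z
  simp only
  rw [Complex.exp_eq_exp_iff_exists_int]
  exact ⟨-m, by push_cast; ring⟩

lemma zCoeff_fderiv_trd (hφ : ContDiff ℝ (⊤ : ℕ∞) φ)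
    (hz : ∀ x y z, φ (x, y, z + 1) = φ (x, y, z)) (m : ℤ) (v : ℝ × ℝ) :
    zCoeff m (fun p => fderiv ℝ φ p (0, 0, 1)) v =
      2 * Real.pi * Complex.I * m * zCoeff m φ v := by
  have h1 := hφ.continuous
  have h2 : Continuous fun z : ℝ => fderiv ℝ φ (v.1, v.2, z) (0, 0, 1) :=
    (contDiff_fderiv_apply hφ (0, 0, 1)).continuous.comp (by fun_prop)
  have hibp := intervalIntegral.integral_eq_sub_of_hasDerivAt (a := 0) (b := 1)
    (fun z _ => (hasDerivAt_exp_central m z).mul (hasDerivAt_trd hφ v.1 v.2 z))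
    ((by fun_prop : Continuous _).intervalIntegrable _ _)
  have hb : Complex.exp (-(2 * Real.pi * Complex.I * m * (1 : ℝ))) * φ (v.1, v.2, 1) -
      Complex.exp (-(2 * Real.pi * Complex.I * m * (0 : ℝ))) * φ (v.1, v.2, 0) = 0 := by
    have e1 := exp_central_periodic m 0
    have e2 := hz v.1 v.2 0
    simp only [zero_add] at e1 e2
    rw [e1, e2, sub_self]
  rw [← sub_eq_zero, zCoeff, zCoeff, ← intervalIntegral.integral_const_mul,
    ← intervalIntegral.integral_sub ((by fun_prop : Continuous _).intervalIntegrable _ _)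
      ((by fun_prop : Continuous _).intervalIntegrable _ _), ← hb]
  refine Eq.trans ?_ hibp
  congr 1
  ext z
  ring

lemma zCoeff_add_one (hz : ∀ x y z, φ (x, y, z + 1) = φ (x, y, z))
    (hy : ∀ x y z, φ (x, y + 1, z + x) = φ (x, y, z)) (m : ℤ) (x y : ℝ) :
    zCoeff m φ (x, y + 1) =
      Complex.exp (-(2 * Real.pi * Complex.I * m * x)) * zCoeff m φ (x, y) := by
  set F : ℝ → ℂ := fun z =>
    Complex.exp (-(2 * Real.pi * Complex.I * m * z)) * φ (x, y + 1, z) with hF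
  have hper : Function.Periodic F 1 := (exp_central_periodic m).mul fun z => hz x (y + 1) z
  have h1 : zCoeff m φ (x, y + 1) = ∫ z in (0 : ℝ)..1, F (z + x) := by
    rw [intervalIntegral.integral_comp_add_right, zero_add, add_comm 1 x,
      ← hper.intervalIntegral_add_eq 0 x, zero_add, zCoeff]
  rw [h1, zCoeff, ← intervalIntegral.integral_const_mul]
  congr 1
  ext z
  rw [hF]
  simp only
  rw [hy, ← mul_assoc, ← Complex.exp_add]
  congr 2
  push_cast
  ring

end Partials

section Nilmanifold

variable {φ : ℝ × ℝ × ℝ → ℂ}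

lemma continuous_heisX (hφ : ContDiff ℝ (⊤ : ℕ∞) φ) : Continuous (heisX φ) :=
  (contDiff_fderiv_apply hφ _).continuous.add
    ((continuous_fst.comp continuous_snd).smul (contDiff_fderiv_apply hφ _).continuous)

lemma continuous_heisY (hφ : ContDiff ℝ (⊤ : ℕ∞) φ) : Continuous (heisY φ) :=
  (contDiff_fderiv_apply hφ _).continuous

lemma isOpen_heisF (k : ℕ) : IsOpen (heisF k) := isOpen_Ioo.prod (isOpen_Ioo.prod isOpen_Ioo)

lemma closure_heisF {k : ℕ} (hk : 1 ≤ k) :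
    closure (heisF k) = Set.Icc (0 : ℝ) k ×ˢ (Set.Icc (0 : ℝ) 1 ×ˢ Set.Icc (0 : ℝ) 1) := by
  have h : (0 : ℝ) ≠ k := by positivity
  rw [heisF, closure_prod_eq, closure_prod_eq, closure_Ioo h, closure_Ioo zero_ne_one]

lemma integrableOn_heisF {E : Type*} [NormedAddCommGroup E] (k : ℕ) {g : ℝ × ℝ × ℝ → E}
    (hg : Continuous g) : IntegrableOn g (heisF k) :=
  (hg.continuousOn.integrableOn_compact
    (isCompact_Icc.prod (isCompact_Icc.prod isCompact_Icc))).mono_set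
    (Set.prod_mono Set.Ioo_subset_Icc_self
      (Set.prod_mono Set.Ioo_subset_Icc_self Set.Ioo_subset_Icc_self))

lemma setIntegral_heisF (k : ℕ) {g : ℝ × ℝ × ℝ → ℝ} (hg : Continuous g) :
    ∫ p in heisF k, g p =
      ∫ x in (0 : ℝ)..k, ∫ y in (0 : ℝ)..1, ∫ z in (0 : ℝ)..1, g (x, y, z) := by
  have h1 : ∀ x, IntegrableOn (fun v : ℝ × ℝ => g (x, v))
      (Set.Ioo (0 : ℝ) 1 ×ˢ Set.Ioo (0 : ℝ) 1) :=
    fun x => ((by fun_prop : Continuous fun v : ℝ × ℝ => g (x, v)).continuousOn.integrableOn_compact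
      (isCompact_Icc.prod isCompact_Icc)).mono_set
      (Set.prod_mono Set.Ioo_subset_Icc_self Set.Ioo_subset_Icc_self)
  have h0 := integrableOn_heisF k hg
  rw [heisF, Measure.volume_eq_prod] at h0 ⊢
  rw [setIntegral_prod _ h0, intervalIntegral.integral_of_le (by positivity),
    integral_Ioc_eq_integral_Ioo]
  congr 1
  ext x
  rw [Measure.volume_eq_prod, setIntegral_prod _ (h1 x),
    intervalIntegral.integral_of_le zero_le_one, integral_Ioc_eq_integral_Ioo]
  congr 1
  ext y
  rw [intervalIntegral.integral_of_le zero_le_one, integral_Ioc_eq_integral_Ioo]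

/-- A continuous nonzero `Γ_k`-invariant function has positive `L²` norm. -/
lemma integral_norm_sq_pos {k : ℕ} (hk : 1 ≤ k) (hφ : Continuous φ)
    (hinv : ∀ x y z : ℝ, φ (x + k, y, z) = φ (x, y, z) ∧
      φ (x, y + 1, z + x) = φ (x, y, z) ∧ φ (x, y, z + 1) = φ (x, y, z))
    (hne : ∃ p, φ p ≠ 0) : 0 < ∫ p in heisF k, ‖φ p‖ ^ 2 := by
  by_contra hcon
  have h0 : ∫ p in heisF k, ‖φ p‖ ^ 2 = 0 :=
    le_antisymm (not_lt.1 hcon) (integral_nonneg fun p => by positivity)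
  have hc : Continuous fun p => ‖φ p‖ ^ 2 := by fun_prop
  rw [setIntegral_eq_zero_iff_of_nonneg_ae (Filter.Eventually.of_forall fun p => by positivity)
    (integrableOn_heisF k hc)] at h0
  have h1 : Set.EqOn φ 0 (closure (heisF k)) := by
    refine Set.EqOn.closure ?_ hφ continuous_const
    intro p hp
    have := Measure.eqOn_open_of_ae_eq h0 (isOpen_heisF k) hc.continuousOn
      continuousOn_const hp
    simpa using this
  obtain ⟨⟨x, y, z⟩, hp⟩ := hne
  apply hp
  have hk0 : (0 : ℝ) < k := by positivity
  have px : ∀ y z, Function.Periodic (fun x => φ (x, y, z)) k := fun y z x => (hinv x y z).1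
  have py : ∀ x y z, Function.Periodic (fun t => φ (x, y + t, z + t * x)) 1 := fun x y z t => by
    refine Eq.trans ?_ (hinv x (y + t) (z + t * x)).2.1
    simp only [add_assoc, add_mul, one_mul]
  have pz : ∀ x y, Function.Periodic (fun z => φ (x, y, z)) 1 := fun x y z => (hinv x y z).2.2
  obtain ⟨x', hx', ex⟩ := (px y z).exists_mem_Ico₀ hk0 x
  have ey := (py x' y z).sub_int_mul_eq (x := 0) ⌊y⌋
  simp only [mul_one, add_zero, zero_mul, zero_sub] at ey
  obtain ⟨z', hz', ez⟩ := (pz x' (y + -(⌊y⌋ : ℝ))).exists_mem_Ico₀ one_pos (z + -(⌊y⌋ : ℝ) * x')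
  rw [ex, ← ey, ez]
  refine h1 ?_
  rw [closure_heisF hk]
  refine ⟨Set.Ico_subset_Icc_self hx', ⟨?_, ?_⟩, Set.Ico_subset_Icc_self hz'⟩
  · have := Int.floor_le y
    simp only
    linarith
  · have := Int.lt_floor_add_one y
    simp only
    linarith

/-- The spectral lower bound. -/
lemma min_mul_integral_heisF_le {k : ℕ} (hk : 1 ≤ k) (a b : ℝ) (hφ : ContDiff ℝ (⊤ : ℕ∞) φ)
    (hinv : ∀ x y z : ℝ, φ (x + k, y, z) = φ (x, y, z) ∧
      φ (x, y + 1, z + x) = φ (x, y, z) ∧ φ (x, y, z + 1) = φ (x, y, z)) :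
    min (distZ a (2 * Real.pi / k) ^ 2 + distZ b (2 * Real.pi) ^ 2) (2 * Real.pi) *
        ∫ p in heisF k, ‖φ p‖ ^ 2 ≤
      ∫ p in heisF k, (‖heisX φ p + Complex.I * (a : ℂ) * φ p‖ ^ 2 +
        ‖heisY φ p + Complex.I * (b : ℂ) * φ p‖ ^ 2) := by
  have hk0 : (0 : ℝ) < k := by positivity
  have hc := hφ.continuous
  have hd := contDiff_fderiv_apply hφ
  have hX := continuous_heisX hφ
  have hY := continuous_heisY hφ
  have hP : Continuous fun p => heisX φ p + Complex.I * a * φ p := by fun_prop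
  have hQ : Continuous fun p => heisY φ p + Complex.I * b * φ p := by fun_prop
  have hP2 : Continuous fun p => ‖heisX φ p + Complex.I * a * φ p‖ ^ 2 := by fun_prop
  have hQ2 : Continuous fun p => ‖heisY φ p + Complex.I * b * φ p‖ ^ 2 := by fun_prop
  rw [integral_add (integrableOn_heisF k hP2) (integrableOn_heisF k hQ2),
    setIntegral_heisF k hP2, setIntegral_heisF k hQ2, setIntegral_heisF k (by fun_prop)]
  refine hasSum_le (fun m => ?_) ((hasSum_integral_norm_sq_zCoeff hc k).mul_left _)
    ((hasSum_integral_norm_sq_zCoeff hP k).add (hasSum_integral_norm_sq_zCoeff hQ k))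
  have cP : ∀ v, zCoeff m (fun p => heisX φ p + Complex.I * a * φ p) v =
      zCoeff m (fun p => fderiv ℝ φ p (1, 0, 0)) v +
        v.2 * (2 * Real.pi * Complex.I * m * zCoeff m φ v) + Complex.I * a * zCoeff m φ v :=
    fun v => by
      rw [zCoeff_add m hX (by fun_prop), zCoeff_const_mul]
      unfold heisX
      rw [zCoeff_add m (hd _).continuous
        (h := fun p => p.2.1 • fderiv ℝ φ p (0, 0, 1))
        ((continuous_fst.comp continuous_snd).smul (hd _).continuous), zCoeff_snd_smul,
        zCoeff_fderiv_trd hφ fun x y z => (hinv x y z).2.2]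
  have cQ : ∀ v, zCoeff m (fun p => heisY φ p + Complex.I * b * φ p) v =
      zCoeff m (fun p => fderiv ℝ φ p (0, 1, 0)) v + Complex.I * b * zCoeff m φ v :=
    fun v => by
      rw [zCoeff_add m hY (by fun_prop), zCoeff_const_mul]
      rfl
  have iP : Continuous fun v => ‖zCoeff m (fun p => heisX φ p + Complex.I * a * φ p) v‖ ^ 2 :=
    (continuous_zCoeff m hP).norm.pow 2
  have iQ : Continuous fun v => ‖zCoeff m (fun p => heisY φ p + Complex.I * b * φ p) v‖ ^ 2 :=
    (continuous_zCoeff m hQ).norm.pow 2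
  have key := min_mul_integral_norm_sq_le (a := a) (b := b) (m := m) hk0 (f := zCoeff m φ)
    (fxy := zCoeff m fun p => fderiv ℝ (fun p => fderiv ℝ φ p (0, 1, 0)) p (1, 0, 0))
    (continuous_zCoeff m hc)
    (continuous_zCoeff m (hd (1, 0, 0)).continuous)
    (continuous_zCoeff m (hd (0, 1, 0)).continuous)
    (continuous_zCoeff m (contDiff_fderiv_apply (hd (0, 1, 0)) (1, 0, 0)).continuous)
    (hasDerivAt_zCoeff_fst hφ m) (hasDerivAt_zCoeff_snd hφ m)
    (hasDerivAt_zCoeff_fst (hd (0, 1, 0)) m)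
    (fun x y => by
      simp only [fderiv_fderiv_apply_comm hφ (0, 1, 0) (1, 0, 0)]
      exact hasDerivAt_zCoeff_snd (hd (1, 0, 0)) m x y)
    (fun x y => by simp only [zCoeff, (hinv _ _ _).1])
    (zCoeff_add_one (fun x y z => (hinv x y z).2.2) (fun x y z => (hinv x y z).2.1) m)
  refine key.trans_eq ?_
  rw [← intervalIntegral.integral_add
    ((continuous_intervalIntegral_snd iP 0 1).intervalIntegrable _ _)
    ((continuous_intervalIntegral_snd iQ 0 1).intervalIntegrable _ _)]
  congr 1
  ext x
  refine Eq.trans ?_ (intervalIntegral.integral_add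
    ((iP.comp (Continuous.prodMk_right x)).intervalIntegrable _ _)
    ((iQ.comp (Continuous.prodMk_right x)).intervalIntegrable _ _))
  simp only [cP, cQ]

end Nilmanifold

/-- Plane waves realise the first branch of the minimum. -/
lemma distZ_sq_add_distZ_sq_mem_heisRayleighSet {k : ℕ} (hk : 1 ≤ k) (a b : ℝ) :
    distZ a (2 * Real.pi / k) ^ 2 + distZ b (2 * Real.pi) ^ 2 ∈ heisRayleighSet k a b := by
  have hk0 : (0 : ℝ) < k := by positivity
  have hkC : (k : ℂ) ≠ 0 := by exact_mod_cast hk0.ne'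
  obtain ⟨n, hn⟩ := exists_distZ_eq a (c := 2 * Real.pi / k) (by positivity)
  obtain ⟨l, hl⟩ := exists_distZ_eq b (c := 2 * Real.pi) (by positivity)
  set c : ℝ := 2 * Real.pi / k * n with hc
  set d : ℝ := 2 * Real.pi * l with hd
  set φ : ℝ × ℝ × ℝ → ℂ := fun p => Complex.exp (-(Complex.I * (c * p.1 + d * p.2.1))) with hφ
  have hsm : ContDiff ℝ (⊤ : ℕ∞) φ := by
    have h1 : ContDiff ℝ (⊤ : ℕ∞) fun p : ℝ × ℝ × ℝ => (p.1 : ℂ) :=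
      Complex.ofRealCLM.contDiff.comp contDiff_fst
    have h2 : ContDiff ℝ (⊤ : ℕ∞) fun p : ℝ × ℝ × ℝ => (p.2.1 : ℂ) :=
      Complex.ofRealCLM.contDiff.comp (contDiff_fst.comp contDiff_snd)
    exact (contDiff_const.mul ((contDiff_const.mul h1).add (contDiff_const.mul h2))).neg.cexp
  have hinv : ∀ x y z : ℝ, φ (x + k, y, z) = φ (x, y, z) ∧
      φ (x, y + 1, z + x) = φ (x, y, z) ∧ φ (x, y, z + 1) = φ (x, y, z) := fun x y z => by
    refine ⟨?_, ?_, rfl⟩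
    · simp only [hφ, hc]
      rw [Complex.exp_eq_exp_iff_exists_int]
      refine ⟨-n, ?_⟩
      push_cast
      field_simp
      ring
    · simp only [hφ, hd]
      rw [Complex.exp_eq_exp_iff_exists_int]
      refine ⟨-l, ?_⟩
      push_cast
      ring
  have hnorm : ∀ p, ‖φ p‖ = 1 := fun p => by simp [hφ, Complex.norm_exp]
  have hne : ∃ p, φ p ≠ 0 := ⟨0, Complex.exp_ne_zero _⟩
  have dx : ∀ x y z, fderiv ℝ φ (x, y, z) (1, 0, 0) = -(Complex.I * c) * φ (x, y, z) :=
    fun x y z => (hasDerivAt_fst hsm x y z).unique <| by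
      refine (((Complex.ofRealCLM.hasDerivAt (x := x)).const_mul (c : ℂ)).add_const
        (d * y : ℂ)).const_mul Complex.I |>.neg.cexp.congr_deriv ?_
      simp [hφ, mul_comm]
  have dy : ∀ x y z, fderiv ℝ φ (x, y, z) (0, 1, 0) = -(Complex.I * d) * φ (x, y, z) :=
    fun x y z => (hasDerivAt_snd hsm x y z).unique <| by
      refine (((Complex.ofRealCLM.hasDerivAt (x := y)).const_mul (d : ℂ)).const_add
        (c * x : ℂ)).const_mul Complex.I |>.neg.cexp.congr_deriv ?_
      simp [hφ, mul_comm]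
  have dz : ∀ x y z, fderiv ℝ φ (x, y, z) (0, 0, 1) = 0 :=
    fun x y z => (hasDerivAt_trd hsm x y z).unique (hasDerivAt_const z (φ (x, y, z)))
  refine ⟨φ, hsm, hinv, hne, ?_⟩
  rw [eq_div_iff (integral_norm_sq_pos hk hsm.continuous hinv hne).ne', ← integral_const_mul]
  congr 1
  ext ⟨x, y, z⟩
  have hX : heisX φ (x, y, z) + Complex.I * a * φ (x, y, z) =
      Complex.I * ((a - c : ℝ) : ℂ) * φ (x, y, z) := by
    simp only [heisX, dx, dz]
    push_cast
    simp
    ring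
  have hY : heisY φ (x, y, z) + Complex.I * b * φ (x, y, z) =
      Complex.I * ((b - d : ℝ) : ℂ) * φ (x, y, z) := by
    simp only [heisY, dy]
    push_cast
    ring
  rw [hX, hY, hn, hl]
  simp only [norm_mul, hnorm, Complex.norm_I, Complex.norm_real, Real.norm_eq_abs]
  ring

lemma differentiable_jacobiTheta₂_I : Differentiable ℂ fun w => jacobiTheta₂ w Complex.I :=
  fun w => differentiableAt_jacobiTheta₂_fst w (by simp)

lemma jacobiTheta₂_zero_I_ne_zero : jacobiTheta₂ 0 Complex.I ≠ 0 := by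
  have h := hasSum_jacobiTheta₂_term 0 (τ := Complex.I) (by simp)
  have hterm : ∀ n : ℤ, jacobiTheta₂_term n 0 Complex.I = (Real.exp (-(Real.pi * n ^ 2)) : ℝ) :=
    fun n => by
      rw [jacobiTheta₂_term, Complex.ofReal_exp]
      congr 1
      push_cast
      linear_combination (Real.pi * (n : ℂ) ^ 2) * Complex.I_mul_I
  simp only [hterm] at h
  have hre := Complex.hasSum_re h
  simp only [Complex.ofReal_re] at hre
  have hpos : 0 < (jacobiTheta₂ 0 Complex.I).re := by
    rw [← hre.tsum_eq]
    exact hre.summable.tsum_pos (fun n => (Real.exp_pos _).le) 0 (Real.exp_pos _)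
  intro h0
  simp [h0] at hpos

/-- A lowest Landau level state, given by a theta function, realises the second branch of the
minimum. -/
lemma two_pi_mem_heisRayleighSet {k : ℕ} (hk : 1 ≤ k) (a b : ℝ) :
    2 * Real.pi ∈ heisRayleighSet k a b := by
  set Θ : ℂ → ℂ := fun w => jacobiTheta₂ w Complex.I with hΘ
  set α : ℂ := a / (2 * Real.pi) with hα
  set A : ℝ × ℝ × ℝ → ℂ := fun p =>
    2 * Real.pi * Complex.I * p.2.2 - Real.pi * (p.2.1 + α) ^ 2 - Complex.I * b * p.2.1 with hA
  set w : ℝ × ℝ × ℝ → ℂ := fun p =>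
    p.1 + Complex.I * (p.2.1 + α) - b / (2 * Real.pi) with hw
  set φ : ℝ × ℝ × ℝ → ℂ := fun p => Complex.exp (A p) * Θ (w p) with hφ
  have φ_apply : ∀ x y z, φ (x, y, z) = Complex.exp (A (x, y, z)) * Θ (w (x, y, z)) :=
    fun _ _ _ => rfl
  have hsm : ContDiff ℝ (⊤ : ℕ∞) φ := by
    have h1 : ContDiff ℝ (⊤ : ℕ∞) fun p : ℝ × ℝ × ℝ => (p.1 : ℂ) :=
      Complex.ofRealCLM.contDiff.comp contDiff_fst
    have h2 : ContDiff ℝ (⊤ : ℕ∞) fun p : ℝ × ℝ × ℝ => (p.2.1 : ℂ) :=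
      Complex.ofRealCLM.contDiff.comp (contDiff_fst.comp contDiff_snd)
    have h3 : ContDiff ℝ (⊤ : ℕ∞) fun p : ℝ × ℝ × ℝ => (p.2.2 : ℂ) :=
      Complex.ofRealCLM.contDiff.comp (contDiff_snd.comp contDiff_snd)
    have hΘs : ContDiff ℝ (⊤ : ℕ∞) Θ :=
      (differentiable_jacobiTheta₂_I.contDiff (n := (⊤ : ℕ∞))).restrict_scalars ℝ
    have hAs : ContDiff ℝ (⊤ : ℕ∞) A :=
      ((contDiff_const.mul h3).sub (contDiff_const.mul ((h2.add contDiff_const).pow 2))).sub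
        (contDiff_const.mul h2)
    have hws : ContDiff ℝ (⊤ : ℕ∞) w :=
      (h1.add (contDiff_const.mul (h2.add contDiff_const))).sub contDiff_const
    exact hAs.cexp.mul (hΘs.comp hws)
  have hinv : ∀ x y z : ℝ, φ (x + k, y, z) = φ (x, y, z) ∧
      φ (x, y + 1, z + x) = φ (x, y, z) ∧ φ (x, y, z + 1) = φ (x, y, z) := fun x y z => by
    refine ⟨?_, ?_, ?_⟩
    · have hper : Function.Periodic Θ 1 := fun v => jacobiTheta₂_add_left v Complex.I
      have hwk : w (x + k, y, z) = w (x, y, z) + k * 1 := by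
        simp only [hw]
        push_cast
        ring
      simp only [hφ, hwk, hper.nat_mul k (w (x, y, z))]
      rfl
    · have hw1 : w (x, y + 1, z + x) = w (x, y, z) + Complex.I := by
        simp only [hw]
        push_cast
        ring
      simp only [hφ, hw1, hΘ]
      rw [jacobiTheta₂_add_left', ← mul_assoc, ← Complex.exp_add]
      congr 2
      simp only [hA, hw]
      push_cast
      field_simp
      linear_combination (-(Real.pi : ℂ) - 2 * Real.pi * (y + α)) * Complex.I_mul_I
    · simp only [hφ]
      congr 1
      rw [Complex.exp_eq_exp_iff_exists_int]
      refine ⟨1, ?_⟩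
      simp only [hA]
      push_cast
      ring
  have hne : ∃ p, φ p ≠ 0 := by
    refine ⟨(b / (2 * Real.pi), -(a / (2 * Real.pi)), 0), mul_ne_zero (Complex.exp_ne_zero _) ?_⟩
    have : w (b / (2 * Real.pi), -(a / (2 * Real.pi)), 0) = 0 := by
      simp only [hw, hα]
      push_cast
      ring
    rw [this]
    exact jacobiTheta₂_zero_I_ne_zero
  have hexp : ∀ x y z : ℝ, Complex.exp (A (x, y, z)) =
      Complex.exp (2 * Real.pi * Complex.I * z) * Complex.exp (A (x, y, 0)) := fun x y z => by
    rw [← Complex.exp_add]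
    congr 1
    simp only [hA]
    push_cast
    ring
  have dΘ : ∀ v, HasDerivAt Θ (deriv Θ v) v := fun v =>
    (differentiable_jacobiTheta₂_I v).hasDerivAt
  have dx : ∀ x y z, fderiv ℝ φ (x, y, z) (1, 0, 0) =
      Complex.exp (A (x, y, z)) * deriv Θ (w (x, y, z)) :=
    fun x y z => (hasDerivAt_fst hsm x y z).unique <| by
      have hw' : HasDerivAt (fun x => w (x, y, z)) 1 x :=
        (((Complex.ofRealCLM.hasDerivAt (x := x)).add_const (Complex.I * (y + α))).sub_const
          (b / (2 * Real.pi) : ℂ)).congr_deriv (by simp)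
      refine (((dΘ (w (x, y, z))).comp x hw').const_mul
        (Complex.exp (A (x, y, z)))).congr_deriv ?_
      ring
  have dy : ∀ x y z, fderiv ℝ φ (x, y, z) (0, 1, 0) = Complex.exp (A (x, y, z)) *
      ((-2 * Real.pi * (y + α) - Complex.I * b) * Θ (w (x, y, z)) +
        Complex.I * deriv Θ (w (x, y, z))) :=
    fun x y z => (hasDerivAt_snd hsm x y z).unique <| by
      have hy := Complex.ofRealCLM.hasDerivAt (x := y)
      have hw' : HasDerivAt (fun y => w (x, y, z)) Complex.I y := by
        refine ((((hy.add_const α).const_mul Complex.I).const_add (x : ℂ)).sub_const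
          (b / (2 * Real.pi) : ℂ)).congr_deriv ?_
        simp
      have hA' : HasDerivAt (fun y => A (x, y, z))
          (-2 * Real.pi * (y + α) - Complex.I * b) y := by
        refine (((((hy.add_const α).pow 2).const_mul (Real.pi : ℂ)).const_sub
          (2 * Real.pi * Complex.I * z)).sub (hy.const_mul (Complex.I * b))).congr_deriv ?_
        simp
        ring
      refine (hA'.cexp.mul ((dΘ (w (x, y, z))).comp y hw')).congr_deriv ?_
      simp only [Function.comp_apply]
      ring
  have dz : ∀ x y z, fderiv ℝ φ (x, y, z) (0, 0, 1) = 2 * Real.pi * Complex.I * φ (x, y, z) :=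
    fun x y z => (hasDerivAt_trd hsm x y z).unique <| by
      have hz := Complex.ofRealCLM.hasDerivAt (x := z)
      have hA' : HasDerivAt (fun z => A (x, y, z)) (2 * Real.pi * Complex.I) z := by
        refine (((hz.const_mul (2 * Real.pi * Complex.I)).sub_const
          (Real.pi * (y + α) ^ 2 : ℂ)).sub_const (Complex.I * b * y : ℂ)).congr_deriv ?_
        simp
      refine (hA'.cexp.mul_const (Θ (w (x, y, z)))).congr_deriv ?_
      simp only [hφ]
      ring
  have hc := hsm.continuous
  have hX := continuous_heisX hsm
  have hY := continuous_heisY hsm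
  have hsd := contDiff_fderiv_apply hsm
  have hN : ∀ x y z, ‖φ (x, y, z)‖ ^ 2 = ‖φ (x, y, 0)‖ ^ 2 := fun x y z => by
    simp only [hφ, hexp x y z]
    rw [norm_mul, norm_mul, norm_mul, Complex.norm_exp]
    simp [hw]
  have hE : ∀ x y z, ‖heisX φ (x, y, z) + Complex.I * a * φ (x, y, z)‖ ^ 2 +
      ‖heisY φ (x, y, z) + Complex.I * b * φ (x, y, z)‖ ^ 2 =
      ‖fderiv ℝ φ (x, y, 0) (1, 0, 0) + y * (2 * Real.pi * Complex.I * (1 : ℤ) * φ (x, y, 0)) +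
        Complex.I * a * φ (x, y, 0)‖ ^ 2 +
      ‖fderiv ℝ φ (x, y, 0) (0, 1, 0) + Complex.I * b * φ (x, y, 0)‖ ^ 2 := fun x y z => by
    have hwz : w (x, y, z) = w (x, y, 0) := rfl
    have hu : ‖Complex.exp (2 * Real.pi * Complex.I * z)‖ = 1 := by simp [Complex.norm_exp]
    have e1 : heisX φ (x, y, z) + Complex.I * a * φ (x, y, z) =
        Complex.exp (2 * Real.pi * Complex.I * z) * (fderiv ℝ φ (x, y, 0) (1, 0, 0) +
          y * (2 * Real.pi * Complex.I * (1 : ℤ) * φ (x, y, 0)) +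
          Complex.I * a * φ (x, y, 0)) := by
      simp only [heisX, dx, dz, φ_apply, hexp x y z, hwz, Complex.real_smul]
      push_cast
      ring
    have e2 : heisY φ (x, y, z) + Complex.I * b * φ (x, y, z) =
        Complex.exp (2 * Real.pi * Complex.I * z) *
          (fderiv ℝ φ (x, y, 0) (0, 1, 0) + Complex.I * b * φ (x, y, 0)) := by
      simp only [heisY, dy, φ_apply, hexp x y z, hwz]
      ring
    rw [e1, e2, norm_mul, norm_mul, hu, one_mul, one_mul]
  refine ⟨φ, hsm, hinv, hne, ?_⟩
  rw [eq_div_iff (integral_norm_sq_pos hk hc hinv hne).ne', setIntegral_heisF k (by fun_prop),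
    setIntegral_heisF k (by fun_prop)]
  simp only [hN, hE, intervalIntegral.integral_const, sub_zero, one_smul]
  have key := integral_norm_sq_creation (L := k) (a := a) (b := b) (s := 1) (m := 1) (by norm_num)
    (f := fun v => φ (v.1, v.2, 0)) (fx := fun v => fderiv ℝ φ (v.1, v.2, 0) (1, 0, 0))
    (fy := fun v => fderiv ℝ φ (v.1, v.2, 0) (0, 1, 0))
    (fxy := fun v => fderiv ℝ (fun p => fderiv ℝ φ p (0, 1, 0)) (v.1, v.2, 0) (1, 0, 0))
    (by fun_prop)
    ((hsd (1, 0, 0)).continuous.comp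
      (by fun_prop : Continuous fun v : ℝ × ℝ => (v.1, v.2, (0 : ℝ))))
    ((hsd (0, 1, 0)).continuous.comp
      (by fun_prop : Continuous fun v : ℝ × ℝ => (v.1, v.2, (0 : ℝ))))
    ((contDiff_fderiv_apply (hsd (0, 1, 0)) (1, 0, 0)).continuous.comp
      (by fun_prop : Continuous fun v : ℝ × ℝ => (v.1, v.2, (0 : ℝ))))
    (fun x y => hasDerivAt_fst hsm x y 0) (fun x y => hasDerivAt_snd hsm x y 0)
    (fun x y => hasDerivAt_fst (hsd (0, 1, 0)) x y 0)
    (fun x y => by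
      simp only [fderiv_fderiv_apply_comm hsm (0, 1, 0) (1, 0, 0)]
      exact hasDerivAt_snd (hsd (1, 0, 0)) x y 0)
    (fun x y => (hinv x y 0).1)
    (fun x y => by
      have h := (hinv x y (-x)).2.1
      rw [neg_add_cancel] at h
      change φ (x, y + 1, 0) = _ * φ (x, y, 0)
      rw [h, φ_apply, φ_apply, hexp x y (-x), mul_assoc]
      congr 2
      push_cast
      ring)
  have hzero : ∀ x y : ℝ, (fderiv ℝ φ (x, y, 0) (1, 0, 0) +
      y * (2 * Real.pi * Complex.I * (1 : ℤ) * φ (x, y, 0)) + Complex.I * a * φ (x, y, 0)) +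
      (1 : ℝ) * Complex.I *
        (fderiv ℝ φ (x, y, 0) (0, 1, 0) + Complex.I * b * φ (x, y, 0)) = 0 := fun x y => by
    have hαa : 2 * Real.pi * α = a := by
      rw [hα]
      field_simp
    simp only [dx, dy, φ_apply]
    push_cast
    linear_combination (Complex.exp (A (x, y, 0)) * deriv Θ (w (x, y, 0))) * Complex.I_mul_I -
      (Complex.I * Complex.exp (A (x, y, 0)) * Θ (w (x, y, 0))) * hαa
  simp only [hzero] at key
  simp only [norm_zero, ne_eq, OfNat.ofNat_ne_zero, not_false_eq_true, zero_pow,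
    intervalIntegral.integral_zero, Int.cast_one, mul_one] at key ⊢
  linarith

/-- **First eigenvalue of the magnetic horizontal Laplacian on `Γ_k \ ℍ¹`.**
The infimum of the magnetic Rayleigh quotients over smooth nonzero
`Γ_k`-invariant functions equals
`min{dist(a,(2π/k)ℤ)² + dist(b,2πℤ)², 2π}`, and it is attained. -/
theorem heisenberg_nilmanifold_first_eigenvalue (k : ℕ) (hk : 1 ≤ k) (a b : ℝ) :
    IsLeast (heisRayleighSet k a b)
      (min (distZ a (2 * Real.pi / k) ^ 2 + distZ b (2 * Real.pi) ^ 2)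
        (2 * Real.pi)) := by
  refine ⟨?_, ?_⟩
  · rcases min_choice (distZ a (2 * Real.pi / k) ^ 2 + distZ b (2 * Real.pi) ^ 2)
      (2 * Real.pi) with h | h <;> rw [h]
    · exact distZ_sq_add_distZ_sq_mem_heisRayleighSet hk a b
    · exact two_pi_mem_heisRayleighSet hk a b
  · rintro r ⟨φ, hφ, hinv, hne, rfl⟩
    rw [le_div_iff₀ (integral_norm_sq_pos hk hφ.continuous hinv hne)]
    exact min_mul_integral_heisF_le hk a b hφ hinv
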